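/- Let T be a compactly generated R-linear triangulated category. A nonzero localizing subcategory S of T is minimal (i.e. S has no nonzero proper localizing subcategories) if and only if Hom*_T(X,Y) ≠ 0 for every pair of nonzero objects X, Y in S. -/

import Mathlib

open CategoryTheory CategoryTheory.Limits CategoryTheory.Pretriangulated

universe w v u u'

namespace BIK

section RingDefs

variable {R : Type u} [Ring R] (𝒜 : ℤ → AddSubgroup R) [GradedRing 𝒜]

/-- `R` is graded-commutative: `a * b = (-1)^{|a||b|} b * a` for homogeneous `a`, `b`. -/
def IsGradedComm : Prop :=
  ∀ (i j : ℤ) (a b : R), a ∈ 𝒜 i → b ∈ 𝒜 j →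
    a * b = ((-1 : ℤ) ^ (i * j).natAbs) • (b * a)

/-- A homogeneous ideal is prime if it is proper and for homogeneous elements `a`, `b`,
`a * b ∈ P` implies `a ∈ P` or `b ∈ P`. -/
structure IsHomPrime (P : HomogeneousIdeal 𝒜) : Prop where
  ne_top : P.toIdeal ≠ ⊤
  mem_or_mem : ∀ {i j : ℤ} {a b : R}, a ∈ 𝒜 i → b ∈ 𝒜 j →
    a * b ∈ P.toIdeal → a ∈ P.toIdeal ∨ b ∈ P.toIdeal

/-- `Spec R`: the set of homogeneous prime ideals of the graded ring `R`. -/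
def SpecR : Type u := {P : HomogeneousIdeal 𝒜 // IsHomPrime 𝒜 P}

variable {𝒜}

/-- `V(𝔞)`, the set of homogeneous primes containing the ideal `𝔞`. -/
def specV (𝔞 : Ideal R) : Set (SpecR 𝒜) := {p | 𝔞 ≤ p.1.toIdeal}

/-- A subset of `Spec R` is specialization closed if with any point it contains all larger
primes. -/
def SpecClosed (V : Set (SpecR 𝒜)) : Prop :=
  ∀ p q : SpecR 𝒜, p ∈ V → p.1.toIdeal ≤ q.1.toIdeal → q ∈ V

/-- `Z(p) = { q | q ⊄ p }`. -/
def Zset (p : SpecR 𝒜) : Set (SpecR 𝒜) := {q | ¬ q.1.toIdeal ≤ p.1.toIdeal}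

/-- `V(p) = { q | q ⊇ p }`. -/
def Vp (p : SpecR 𝒜) : Set (SpecR 𝒜) := {q | p.1.toIdeal ≤ q.1.toIdeal}

/-- The specialization closure of a subset of `Spec R`. -/
def specCl (U : Set (SpecR 𝒜)) : Set (SpecR 𝒜) := {p | ∃ q ∈ U, q.1.toIdeal ≤ p.1.toIdeal}

/-- The subset `U ⊆ Spec R` has finite dimension: the lengths of strict chains of primes in `U`
are bounded. -/
def FiniteDim (U : Set (SpecR 𝒜)) : Prop :=
  ∃ n : ℕ, ∀ (m : ℕ) (c : Fin (m + 1) → SpecR 𝒜), (∀ i, c i ∈ U) →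
    (StrictMono fun i => (c i).1.toIdeal) → m ≤ n

end RingDefs

section CatDefs

variable (T : Type u') [Category.{v} T] [HasZeroObject T] [Preadditive T] [HasShift T ℤ]
  [∀ n : ℤ, (CategoryTheory.shiftFunctor T n).Additive] [Pretriangulated T]
  [HasCoproducts.{v} T]

/-- The canonical map `⨁ⱼ Hom(C, fⱼ) → Hom(C, ∐ f)`. -/
noncomputable def sigmaHom (C : T) {J : Type v} (f : J → T) :
    (DirectSum J fun j => (C ⟶ f j)) →+ (C ⟶ ∐ f) :=
  letI := Classical.decEq J
  DirectSum.toAddMonoid fun j =>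
    AddMonoidHom.mk' (fun g => g ≫ Sigma.ι f j) (fun g h => by simp)

/-- An object `C` is compact if `Hom(C, -)` commutes with arbitrary coproducts. -/
def IsCompactObj (C : T) : Prop :=
  ∀ (J : Type v) (f : J → T), Function.Bijective (sigmaHom T C f)

/-- A localizing subcategory: a (strictly full) triangulated subcategory closed under
arbitrary coproducts. -/
structure IsLocalizing (S : Set T) : Prop where
  zero_mem : ∀ X : T, Limits.IsZero X → X ∈ S
  iso_mem : ∀ {X Y : T}, (X ≅ Y) → X ∈ S → Y ∈ S
  shift_mem : ∀ X ∈ S, ∀ n : ℤ, X⟦n⟧ ∈ S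
  ext_mem : ∀ Tr ∈ distTriang T, Tr.obj₁ ∈ S → Tr.obj₂ ∈ S → Tr.obj₃ ∈ S
  coprod_mem : ∀ (J : Type v) (f : J → T), (∀ j, f j ∈ S) → (∐ f) ∈ S

/-- The localizing subcategory generated by a class of objects. -/
def Loc (A : Set T) : Set T := ⋂₀ {S | IsLocalizing T S ∧ A ⊆ S}

/-- A thick subcategory: a (strictly full) triangulated subcategory closed under
direct summands (i.e. retracts). -/
structure IsThick (S : Set T) : Prop where
  zero_mem : ∀ X : T, Limits.IsZero X → X ∈ S
  iso_mem : ∀ {X Y : T}, (X ≅ Y) → X ∈ S → Y ∈ S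
  shift_mem : ∀ X ∈ S, ∀ n : ℤ, X⟦n⟧ ∈ S
  ext_mem : ∀ Tr ∈ distTriang T, Tr.obj₁ ∈ S → Tr.obj₂ ∈ S → Tr.obj₃ ∈ S
  retract_mem : ∀ X Y : T, Y ∈ S → ∀ (i : X ⟶ Y) (p : Y ⟶ X), i ≫ p = 𝟙 X → X ∈ S

/-- The thick subcategory generated by a class of objects. -/
def ThickSub (A : Set T) : Set T := ⋂₀ {S | IsThick T S ∧ A ⊆ S}

/-- `T` is compactly generated: it is generated, as a localizing subcategory,
by a set of compact objects. -/
def CompactlyGen : Prop :=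
  ∃ (ι : Type v) (g : ι → T), (∀ i, IsCompactObj T (g i)) ∧ Loc T (Set.range g) = Set.univ

end CatDefs

section Action

variable {R : Type u} [Ring R] (𝒜 : ℤ → AddSubgroup R) [GradedRing 𝒜]
variable (T : Type u') [Category.{v} T] [HasZeroObject T] [Preadditive T] [HasShift T ℤ]
  [∀ n : ℤ, (CategoryTheory.shiftFunctor T n).Additive] [Pretriangulated T]
  [HasCoproducts.{v} T]

/-- An action of the graded ring `R` on the triangulated category `T`, i.e. a homomorphism of
graded rings from `R` to the graded center of `T`: each homogeneous `a ∈ R` of degree `i`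
determines a natural transformation `Id → Σⁱ` commuting with the shift up to the sign
`(-1)^i`. -/
structure CenterAction where
  act : ∀ (i : ℤ) (a : R), a ∈ 𝒜 i → ∀ X : T, X ⟶ X⟦i⟧
  act_add : ∀ (i : ℤ) (a b : R) (ha : a ∈ 𝒜 i) (hb : b ∈ 𝒜 i) (X : T),
    act i (a + b) (add_mem ha hb) X = act i a ha X + act i b hb X
  act_one : ∀ X : T, act 0 1 (SetLike.one_mem_graded 𝒜) X = (shiftFunctorZero T ℤ).inv.app X
  act_mul : ∀ (i j : ℤ) (a b : R) (ha : a ∈ 𝒜 i) (hb : b ∈ 𝒜 j) (X : T),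
    act (i + j) (a * b) (SetLike.mul_mem_graded ha hb) X
      = act j b hb X ≫ act i a ha (X⟦j⟧) ≫ (shiftFunctorAdd' T j i (i + j) (by ring)).inv.app X
  act_natural : ∀ (i : ℤ) (a : R) (ha : a ∈ 𝒜 i) {X Y : T} (f : X ⟶ Y),
    f ≫ act i a ha Y = act i a ha X ≫ f⟦i⟧'
  act_shift : ∀ (i : ℤ) (a : R) (ha : a ∈ 𝒜 i) (X : T) (n : ℤ),
    act i a ha (X⟦n⟧)
      = ((-1 : ℤ) ^ (i * n).natAbs) • ((act i a ha X)⟦n⟧' ≫ (shiftComm X i n).hom)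

variable {𝒜 T}

/-- The action of a homogeneous element of `R` on the graded abelian group
`Hom*(X, Y) = ⊕ₙ Hom(X, Y⟦n⟧)`. -/
def CenterAction.hsmul (A : CenterAction 𝒜 T) {i : ℤ} {a : R} (ha : a ∈ 𝒜 i) {X Y : T} {n : ℤ}
    (f : X ⟶ Y⟦n⟧) : X ⟶ Y⟦n + i⟧ :=
  f ≫ A.act i a ha (Y⟦n⟧) ≫ (shiftFunctorAdd' T n i (n + i) rfl).inv.app Y

/-- The homogeneous localization of the graded `R`-module `Hom*(X, Y)` at the homogeneous
prime `p` vanishes: every element is annihilated by some homogeneous `s ∉ p`. -/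
def LocVanishes (A : CenterAction 𝒜 T) (p : SpecR 𝒜) (X Y : T) : Prop :=
  ∀ (n : ℤ) (f : X ⟶ Y⟦n⟧), ∃ (i : ℤ) (s : R) (hs : s ∈ 𝒜 i),
    s ∉ p.1.toIdeal ∧ A.hsmul hs f = 0

variable (T) in
/-- The subcategory `T_V` of `V`-torsion objects, for `V ⊆ Spec R` specialization closed. -/
def TVset (A : CenterAction 𝒜 T) (V : Set (SpecR 𝒜)) : Set T :=
  {X | ∀ C : T, IsCompactObj T C → ∀ p : SpecR 𝒜, p ∉ V → LocVanishes A p C X}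

/-- The local cohomology and localization functors `Γ_V`, `L_V` attached to the `R`-action on
`T`: for each specialization closed `V ⊆ Spec R`, `L_V` is the (essentially unique) localization
functor with `Ker L_V = T_V`, and `Γ_V` is defined by the exact localization triangle
`Γ_V X → X → L_V X → `. -/
structure BIKData (A : CenterAction 𝒜 T) where
  Γ : Set (SpecR 𝒜) → T ⥤ T
  Lf : Set (SpecR 𝒜) → T ⥤ T
  γ : ∀ V : Set (SpecR 𝒜), Γ V ⟶ 𝟭 T
  η : ∀ V : Set (SpecR 𝒜), 𝟭 T ⟶ Lf V
  δ : ∀ (V : Set (SpecR 𝒜)) (X : T), (Lf V).obj X ⟶ ((Γ V).obj X)⟦(1 : ℤ)⟧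
  tri : ∀ V : Set (SpecR 𝒜), SpecClosed V → ∀ X : T,
    Triangle.mk ((γ V).app X) ((η V).app X) (δ V X) ∈ distTriang T
  Lη_iso : ∀ V : Set (SpecR 𝒜), SpecClosed V → ∀ X : T,
    IsIso ((Lf V).map ((η V).app X))
  Lη_eq : ∀ V : Set (SpecR 𝒜), SpecClosed V → ∀ X : T,
    (Lf V).map ((η V).app X) = (η V).app ((Lf V).obj X)
  kerL : ∀ V : Set (SpecR 𝒜), SpecClosed V → ∀ X : T,
    Limits.IsZero ((Lf V).obj X) ↔ X ∈ TVset T A V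

namespace BIKData

variable {A : CenterAction 𝒜 T} (B : BIKData A)

/-- `X_p = L_{Z(p)} X`. -/
def locP (p : SpecR 𝒜) (X : T) : T := (B.Lf (Zset p)).obj X

/-- `Γ_p = Γ_{V(p)} ∘ L_{Z(p)}`. -/
def ΓP (p : SpecR 𝒜) : T ⥤ T := B.Lf (Zset p) ⋙ B.Γ (Vp p)

/-- `supp_R X = { p ∈ Spec R | Γ_p X ≠ 0 }`. -/
def suppObj (X : T) : Set (SpecR 𝒜) := {p | ¬ Limits.IsZero ((B.ΓP p).obj X)}

/-- `supp_R T = ⋃_X supp_R X`. -/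
def suppT : Set (SpecR 𝒜) := {p | ∃ X : T, p ∈ B.suppObj X}

/-- The support of a class of objects. -/
def suppSet (S : Set T) : Set (SpecR 𝒜) := ⋃ X ∈ S, B.suppObj X

/-- `supp_R⁻¹ U`, the class of objects supported in `U`. -/
def invSupp (U : Set (SpecR 𝒜)) : Set T := {X | B.suppObj X ⊆ U}

/-- `Γ_p T`, the essential image of `Γ_p`. -/
def ΓPImage (p : SpecR 𝒜) : Set T := {X | ∃ Y : T, Nonempty (X ≅ (B.ΓP p).obj Y)}

/-- The local-global principle: each object is built from its local cohomology objects. -/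
def LocalGlobal : Prop :=
  ∀ X : T, Loc T {X} = Loc T {Y | ∃ p : SpecR 𝒜, Y = (B.ΓP p).obj X}

end BIKData

/-- A localizing subcategory is minimal if it is nonzero and has no proper nonzero localizing
subcategories. -/
def IsMinimalLoc (S : Set T) : Prop :=
  IsLocalizing T S ∧ (∃ X ∈ S, ¬ Limits.IsZero X) ∧
    ∀ S' : Set T, IsLocalizing T S' → S' ⊆ S →
      (∀ X ∈ S', Limits.IsZero X) ∨ S' = S

/-- `T` is stratified by the `R`-action: the local-global principle holds and each `Γ_p T`
is either zero or a minimal localizing subcategory. -/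
def Stratified {A : CenterAction 𝒜 T} (B : BIKData A) : Prop :=
  B.LocalGlobal ∧
    ∀ p : SpecR 𝒜, (∀ X ∈ B.ΓPImage p, Limits.IsZero X) ∨ IsMinimalLoc (B.ΓPImage p)

/-- A graded `R`-submodule of `Hom*(X,Y)`. -/
structure HomSub (A : CenterAction 𝒜 T) (X Y : T) where
  car : ∀ n : ℤ, AddSubgroup (X ⟶ Y⟦n⟧)
  hsmul_mem : ∀ (i : ℤ) (a : R) (ha : a ∈ 𝒜 i) (n : ℤ) (f : X ⟶ Y⟦n⟧),
    f ∈ car n → A.hsmul ha f ∈ car (n + i)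

/-- The graded `R`-module `Hom*(X,Y)` is finitely generated. -/
def FGHom (A : CenterAction 𝒜 T) (X Y : T) : Prop :=
  ∃ F : Finset ((n : ℤ) × (X ⟶ Y⟦n⟧)),
    ∀ S : HomSub A X Y, (∀ g ∈ F, g.2 ∈ S.car g.1) → ∀ (n : ℤ) (f : X ⟶ Y⟦n⟧), f ∈ S.car n

/-- The `R`-linear category `T` is noetherian: `End*(C)` is a finitely generated `R`-module
for each compact object `C`. -/
def NoetherianT (A : CenterAction 𝒜 T) : Prop :=
  ∀ C : T, IsCompactObj T C → FGHom A C C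

end Action

section Extra

variable {R : Type u} [Ring R] {𝒜 : ℤ → AddSubgroup R} [GradedRing 𝒜]
variable {T : Type u'} [Category.{v} T] [HasZeroObject T] [Preadditive T] [HasShift T ℤ]
  [∀ n : ℤ, (CategoryTheory.shiftFunctor T n).Additive] [Pretriangulated T]
  [HasCoproducts.{v} T]

/-- A subset of `Spec R` closed under generalization. -/
def GenClosed (U : Set (SpecR 𝒜)) : Prop :=
  ∀ p q : SpecR 𝒜, q ∈ U → p.1.toIdeal ≤ q.1.toIdeal → p ∈ U

/-- `Supp_R Hom*(X,Y) = { p | Hom*(X,Y)_p ≠ 0 }`, the big support of the graded `R`-module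
`Hom*(X,Y)`. -/
def bigSuppHom (A : CenterAction 𝒜 T) (X Y : T) : Set (SpecR 𝒜) :=
  {p | ¬ LocVanishes A p X Y}

/-- `Supp_R X = ⋃_{C compact} Supp_R Hom*(C,X)`, the big support of an object. -/
def bigSuppObj (A : CenterAction 𝒜 T) (X : T) : Set (SpecR 𝒜) :=
  {p | ∃ C : T, IsCompactObj T C ∧ ¬ LocVanishes A p C X}

/-- The graded `R`-module `Hom*(X,Y)` is `p`-local: every homogeneous element outside of `p`
acts invertibly on it. -/
def PLocalHom (A : CenterAction 𝒜 T) (p : SpecR 𝒜) (X Y : T) : Prop :=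
  ∀ (i : ℤ) (s : R) (hs : s ∈ 𝒜 i), s ∉ p.1.toIdeal →
    ∀ n : ℤ, Function.Bijective fun f : X ⟶ Y⟦n⟧ => A.hsmul hs f

/-- `K` is a Koszul object `X ⫽ a` of the homogeneous element `a` of degree `i` on `X`,
i.e. there is an exact triangle `X → Σ^i X → K → `, the first map being given by the action
of `a`. -/
def IsKoszul (A : CenterAction 𝒜 T) {i : ℤ} (a : R) (ha : a ∈ 𝒜 i) (X K : T) : Prop :=
  ∃ (w : X⟦i⟧ ⟶ K) (d : K ⟶ X⟦(1 : ℤ)⟧),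
    Triangle.mk (A.act i a ha X) w d ∈ distTriang T

/-- Iterated Koszul object on a finite sequence of homogeneous elements. -/
inductive IsKoszulSeq (A : CenterAction 𝒜 T) :
    T → List ((i : ℤ) × {a : R // a ∈ 𝒜 i}) → T → Prop
  | nil (X : T) : IsKoszulSeq A X [] X
  | cons (X Y K : T) (i : ℤ) (a : {a : R // a ∈ 𝒜 i})
      (l : List ((i : ℤ) × {a : R // a ∈ 𝒜 i})) :
      IsKoszulSeq A X l Y → IsKoszul A a.1 a.2 Y K → IsKoszulSeq A X (⟨i, a⟩ :: l) K

/-- `K` is a Koszul object `X ⫽ 𝔞` of the homogeneous ideal `𝔞` on `X`, obtained by iterating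
the Koszul construction on some finite sequence of homogeneous generators of `𝔞`. -/
def IsKoszulIdeal (A : CenterAction 𝒜 T) (𝔞 : HomogeneousIdeal 𝒜) (X K : T) : Prop :=
  ∃ l : List ((i : ℤ) × {a : R // a ∈ 𝒜 i}),
    Ideal.span {x : R | ∃ s ∈ l, (s.2 : R) = x} = 𝔞.toIdeal ∧ IsKoszulSeq A X l K

end Extra

section Hocolim

variable {T : Type u'} [Category.{v} T] [Preadditive T] [HasCoproductsOfShape ℕ T]

/-- The map `⊕ₙ Xₙ → ⊕ₙ Xₙ` given by `id - fₙ`, whose cone is the homotopy colimit. -/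
noncomputable def hoColimMap {Xs : ℕ → T} (fs : ∀ n, Xs n ⟶ Xs (n + 1)) : (∐ Xs) ⟶ (∐ Xs) :=
  Sigma.desc fun n => Sigma.ι Xs n - fs n ≫ Sigma.ι Xs (n + 1)

variable [HasZeroObject T] [HasShift T ℤ]
  [∀ n : ℤ, (CategoryTheory.shiftFunctor T n).Additive] [Pretriangulated T]

/-- A homotopy colimit of the sequence `X₀ → X₁ → X₂ → ⋯`, defined by an exact triangle
`⊕ Xₙ → ⊕ Xₙ → hocolim Xₙ → `. -/
structure HocolimData (Xs : ℕ → T) (fs : ∀ n, Xs n ⟶ Xs (n + 1)) where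
  pt : T
  ι : (∐ Xs) ⟶ pt
  d : pt ⟶ (∐ Xs)⟦(1 : ℤ)⟧
  tri : Triangle.mk (hoColimMap fs) ι d ∈ distTriang T

end Hocolim

end BIK

set_option linter.unusedSectionVars false

namespace BIK

section Aux

variable {T : Type u'} [Category.{v} T] [HasZeroObject T] [Preadditive T] [HasShift T ℤ]
  [∀ n : ℤ, (CategoryTheory.shiftFunctor T n).Additive] [Pretriangulated T]

/-- A strictly full triangulated subcategory. -/
structure IsTri (S : T → Prop) : Prop where
  zero_mem : ∀ X : T, Limits.IsZero X → S X
  iso_mem : ∀ {X Y : T}, (X ≅ Y) → S X → S Y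
  shift_mem : ∀ X, S X → ∀ n : ℤ, S (X⟦n⟧)
  ext_mem : ∀ Tr ∈ distTriang T, S Tr.obj₁ → S Tr.obj₂ → S Tr.obj₃

lemma IsTri.obj1 {S : T → Prop} (h : IsTri S) (Tr : Triangle T) (hT : Tr ∈ distTriang T)
    (h2 : S Tr.obj₂) (h3 : S Tr.obj₃) : S Tr.obj₁ := by
  have h1 : S (Tr.obj₁⟦(1 : ℤ)⟧) := h.ext_mem _ (rot_of_distTriang _ hT) h2 h3
  exact h.iso_mem ((shiftFunctorCompIsoId T (1 : ℤ) (-1) (by simp)).app Tr.obj₁)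
    (h.shift_mem _ h1 (-1))

lemma IsTri.obj2 {S : T → Prop} (h : IsTri S) (Tr : Triangle T) (hT : Tr ∈ distTriang T)
    (h1 : S Tr.obj₁) (h3 : S Tr.obj₃) : S Tr.obj₂ :=
  h.obj1 _ (rot_of_distTriang _ hT) h3 (h.shift_mem _ h1 1)

lemma IsTri.biprod {S : T → Prop} (h : IsTri S) {X Y : T} (hX : S X) (hY : S Y) : S (X ⊞ Y) :=
  h.obj2 _ (binaryBiproductTriangle_distinguished X Y) hX hY

lemma IsTri.cone {S : T → Prop} (h : IsTri S) {X Y Z : T} {f : X ⟶ Y} {g : Y ⟶ Z}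
    {w : Z ⟶ X⟦(1 : ℤ)⟧} (hT : Triangle.mk f g w ∈ distTriang T) (hX : S X) (hY : S Y) : S Z :=
  h.ext_mem _ hT hX hY

lemma IsTri.fiber {S : T → Prop} (h : IsTri S) {X Y Z : T} {f : X ⟶ Y} {g : Y ⟶ Z}
    {w : Z ⟶ X⟦(1 : ℤ)⟧} (hT : Triangle.mk f g w ∈ distTriang T) (hY : S Y) (hZ : S Z) : S X :=
  h.obj1 _ hT hY hZ

lemma tri_comp {X Y Z : T} {f : X ⟶ Y} {g : Y ⟶ Z}
    {w : Z ⟶ X⟦(1 : ℤ)⟧} (hT : Triangle.mk f g w ∈ distTriang T) : f ≫ g = 0 :=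
  comp_distTriang_mor_zero₁₂ _ hT

lemma tri_desc {X Y Z : T} {f : X ⟶ Y} {g : Y ⟶ Z}
    {w : Z ⟶ X⟦(1 : ℤ)⟧} (hT : Triangle.mk f g w ∈ distTriang T) {W : T} (k : Y ⟶ W)
    (hk : f ≫ k = 0) : ∃ l : Z ⟶ W, g ≫ l = k := by
  obtain ⟨l, hl⟩ := Triangle.yoneda_exact₂ _ hT k hk
  exact ⟨l, hl.symm⟩

lemma tri_desc' {X Y Z : T} {f : X ⟶ Y} {g : Y ⟶ Z}
    {w : Z ⟶ X⟦(1 : ℤ)⟧} (hT : Triangle.mk f g w ∈ distTriang T) {W : T} (k : Z ⟶ W)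
    (hk : g ≫ k = 0) : ∃ l : X⟦(1 : ℤ)⟧ ⟶ W, w ≫ l = k := by
  obtain ⟨l, hl⟩ := Triangle.yoneda_exact₃ _ hT k hk
  exact ⟨l, hl.symm⟩

lemma tri_lift {X Y Z : T} {f : X ⟶ Y} {g : Y ⟶ Z}
    {w : Z ⟶ X⟦(1 : ℤ)⟧} (hT : Triangle.mk f g w ∈ distTriang T) {W : T} (k : W ⟶ Y)
    (hk : k ≫ g = 0) : ∃ l : W ⟶ X, l ≫ f = k := by
  obtain ⟨l, hl⟩ := Triangle.coyoneda_exact₂ _ hT k hk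
  exact ⟨l, hl.symm⟩

lemma tri_lift' {X Y Z : T} {f : X ⟶ Y} {g : Y ⟶ Z}
    {w : Z ⟶ X⟦(1 : ℤ)⟧} (hT : Triangle.mk f g w ∈ distTriang T) {W : T} (k : W ⟶ Z)
    (hk : k ≫ w = 0) : ∃ l : W ⟶ Y, l ≫ g = k := by
  obtain ⟨l, hl⟩ := Triangle.coyoneda_exact₃ _ hT k hk
  exact ⟨l, hl.symm⟩

lemma tri_map {X Y Z : T} {f : X ⟶ Y} {g : Y ⟶ Z}
    {w : Z ⟶ X⟦(1 : ℤ)⟧} (hT : Triangle.mk f g w ∈ distTriang T)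
    {X' Y' Z' : T} {f' : X' ⟶ Y'} {g' : Y' ⟶ Z'}
    {w' : Z' ⟶ X'⟦(1 : ℤ)⟧} (hT' : Triangle.mk f' g' w' ∈ distTriang T)
    (a : X ⟶ X') (b : Y ⟶ Y') (hab : f ≫ b = a ≫ f') : ∃ c : Z ⟶ Z', g ≫ c = b ≫ g' := by
  obtain ⟨c, hc, _⟩ := complete_distinguished_triangle_morphism _ _ hT hT' a b hab
  exact ⟨c, hc⟩

/-- Completing a morphism of triangles given on the last two terms. -/
lemma tri_map1 {X Y Z : T} {f : X ⟶ Y} {g : Y ⟶ Z}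
    {w : Z ⟶ X⟦(1 : ℤ)⟧} (hT : Triangle.mk f g w ∈ distTriang T)
    {X' Y' Z' : T} {f' : X' ⟶ Y'} {g' : Y' ⟶ Z'}
    {w' : Z' ⟶ X'⟦(1 : ℤ)⟧} (hT' : Triangle.mk f' g' w' ∈ distTriang T)
    (b : Y ⟶ Y') (c : Z ⟶ Z') (hbc : g ≫ c = b ≫ g') : ∃ a : X ⟶ X', f ≫ b = a ≫ f' := by
  obtain ⟨a, ha, _⟩ := complete_distinguished_triangle_morphism₁ _ _ hT hT' b c hbc
  exact ⟨a, ha⟩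

lemma ex_cone {X Y : T} (f : X ⟶ Y) : ∃ (Z : T) (g : Y ⟶ Z) (w : Z ⟶ X⟦(1 : ℤ)⟧),
    Triangle.mk f g w ∈ distTriang T := distinguished_cocone_triangle f

lemma ex_fiber {Y Z : T} (g : Y ⟶ Z) : ∃ (X : T) (f : X ⟶ Y) (w : Z ⟶ X⟦(1 : ℤ)⟧),
    Triangle.mk f g w ∈ distTriang T := distinguished_cocone_triangle₁ g

lemma tri_rot {X Y Z : T} {f : X ⟶ Y} {g : Y ⟶ Z}
    {w : Z ⟶ X⟦(1 : ℤ)⟧} (hT : Triangle.mk f g w ∈ distTriang T) :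
    Triangle.mk g w (-f⟦(1 : ℤ)⟧') ∈ distTriang T := rot_of_distTriang _ hT

variable [HasCoproducts.{v} T]

lemma IsLocalizing.isTri {S : Set T} (h : IsLocalizing T S) : IsTri (fun X => X ∈ S) where
  zero_mem := h.zero_mem
  iso_mem := h.iso_mem
  shift_mem := h.shift_mem
  ext_mem := h.ext_mem

/-- Coproducts of exact sequences are exact (in the middle). -/
lemma sigma_exact {J : Type v} {F K Y : J → T} {f : ∀ j, F j ⟶ K j} {g : ∀ j, K j ⟶ Y j}
    {w : ∀ j, Y j ⟶ (F j)⟦(1 : ℤ)⟧} (hT : ∀ j, Triangle.mk (f j) (g j) (w j) ∈ distTriang T)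
    {W : T} (k : W ⟶ ∐ K) (hk : k ≫ Limits.Sigma.map g = 0) :
    ∃ l : W ⟶ ∐ F, l ≫ Limits.Sigma.map f = k := by
  obtain ⟨C, q, r, hC⟩ := ex_cone (Limits.Sigma.map f)
  have h1 : ∀ j, ∃ c : Y j ⟶ C, g j ≫ c = Sigma.ι K j ≫ q := fun j =>
    tri_desc (hT j) _ (by
      rw [← Category.assoc, ← Sigma.ι_map, Category.assoc, tri_comp hC, comp_zero])
  choose c hc using h1
  have h2 : q = Limits.Sigma.map g ≫ Sigma.desc c := by
    ext j; simp [hc]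
  exact tri_lift hC k (by rw [h2, ← Category.assoc, hk, zero_comp])

/-- The comparison isomorphism of shifts with coproducts. -/
noncomputable def shiftSigma {J : Type v} (Y : J → T) (n : ℤ) :
    (∐ Y)⟦n⟧ ≅ ∐ fun j => (Y j)⟦n⟧ :=
  PreservesCoproduct.iso (shiftFunctor T n) Y

lemma ι_shiftSigma_inv {J : Type v} (Y : J → T) (n : ℤ) (j : J) :
    Sigma.ι (fun j => (Y j)⟦n⟧) j ≫ (shiftSigma Y n).inv = (Sigma.ι Y j)⟦n⟧' := by
  simp [shiftSigma, PreservesCoproduct.inv_hom]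

lemma ι_shiftSigma_hom {J : Type v} (Y : J → T) (n : ℤ) (j : J) :
    (Sigma.ι Y j)⟦n⟧' ≫ (shiftSigma Y n).hom = Sigma.ι (fun j => (Y j)⟦n⟧) j := by
  rw [← ι_shiftSigma_inv, Category.assoc, Iso.inv_hom_id, Category.comp_id]

lemma map_shiftSigma_inv {J : Type v} {Z Y : J → T} (z : ∀ j, Z j ⟶ Y j) (n : ℤ) :
    Limits.Sigma.map (fun j => (z j)⟦n⟧') ≫ (shiftSigma Y n).inv =
      (shiftSigma Z n).inv ≫ (Limits.Sigma.map z)⟦n⟧' := by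
  ext j
  rw [Sigma.ι_map_assoc, ι_shiftSigma_inv, ← Category.assoc, ι_shiftSigma_inv,
    ← Functor.map_comp, ← Functor.map_comp, Sigma.ι_map]

/-- The closure of `P` under triangles and coproducts of size at most `κ`. -/
inductive Kcl (P : T → Prop) (κ : Cardinal.{v}) : T → Prop
  | base (X : T) : P X → Kcl P κ X
  | zero (X : T) : Limits.IsZero X → Kcl P κ X
  | iso {X Y : T} : (X ≅ Y) → Kcl P κ X → Kcl P κ Y
  | shift (X : T) (n : ℤ) : Kcl P κ X → Kcl P κ (X⟦n⟧)
  | cone (Tr : Triangle T) : Tr ∈ distTriang T → Kcl P κ Tr.obj₁ → Kcl P κ Tr.obj₂ →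
      Kcl P κ Tr.obj₃
  | coprod (J : Type v) (f : J → T) : Cardinal.mk J ≤ κ → (∀ j, Kcl P κ (f j)) → Kcl P κ (∐ f)

lemma Kcl.isTri (P : T → Prop) (κ : Cardinal.{v}) : IsTri (Kcl P κ) where
  zero_mem := Kcl.zero
  iso_mem := Kcl.iso
  shift_mem X h n := Kcl.shift X n h
  ext_mem := Kcl.cone

lemma Kcl.mono {P Q : T → Prop} {κ μ : Cardinal.{v}} (hPQ : ∀ X, P X → Kcl Q μ X) (h : κ ≤ μ)
    {X : T} (hX : Kcl P κ X) : Kcl Q μ X := by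
  induction hX with
  | base X h => exact hPQ X h
  | zero X h => exact .zero X h
  | iso e _ ih => exact .iso e ih
  | shift X n _ ih => exact .shift X n ih
  | cone Tr hT _ _ ih1 ih2 => exact .cone Tr hT ih1 ih2
  | coprod J f hJ _ ih => exact .coprod J f (hJ.trans h) ih

lemma Kcl.mem_of_localizing {P : T → Prop} {κ : Cardinal.{v}} {S : Set T} (hS : IsLocalizing T S)
    (hPS : ∀ X, P X → X ∈ S) {X : T} (hX : Kcl P κ X) : X ∈ S := by
  induction hX with
  | base X h => exact hPS X h
  | zero X h => exact hS.zero_mem X h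
  | iso e _ ih => exact hS.iso_mem e ih
  | shift X n _ ih => exact hS.shift_mem X ih n
  | cone Tr hT _ _ ih1 ih2 => exact hS.ext_mem Tr hT ih1 ih2
  | coprod J f hJ _ ih => exact hS.coprod_mem J f ih

/-- Removing zero summands from a coproduct. -/
lemma sigma_supp {J : Type v} (f : J → T) (s : Set J) (hs : ∀ j, j ∉ s → IsZero (f j)) :
    Nonempty ((∐ fun j : s => f j) ≅ ∐ f) := by
  classical
  refine ⟨⟨Sigma.desc fun j => Sigma.ι f j,
    Sigma.desc fun j => if h : j ∈ s then Sigma.ι (fun j : s => f j) ⟨j, h⟩ else 0, ?_, ?_⟩⟩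
  · ext ⟨j, hj⟩
    simp [hj]
  · ext j
    by_cases h : j ∈ s
    · simp [h]
    · exact (hs j h).eq_of_src _ _

lemma Kcl.coprod_supp {P : T → Prop} {κ : Cardinal.{v}} {J : Type v} (f : J → T) (s : Set J)
    (hs : ∀ j, j ∉ s → IsZero (f j)) (hκ : Cardinal.mk s ≤ κ) (hf : ∀ j, Kcl P κ (f j)) :
    Kcl P κ (∐ f) :=
  .iso (sigma_supp f s hs).some (.coprod s _ hκ fun j => hf j)

lemma mem_Loc {A : Set T} {X : T} (h : X ∈ A) : X ∈ Loc T A := fun _ hS => hS.2 h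

lemma Loc_le {A S : Set T} (hS : IsLocalizing T S) (h : A ⊆ S) : Loc T A ⊆ S :=
  fun _ hX => hX S ⟨hS, h⟩

lemma Loc_localizing (A : Set T) : IsLocalizing T (Loc T A) where
  zero_mem X h S hS := hS.1.zero_mem X h
  iso_mem e h S hS := hS.1.iso_mem e (h S hS)
  shift_mem X h n S hS := hS.1.shift_mem X (h S hS) n
  ext_mem Tr hT h1 h2 S hS := hS.1.ext_mem Tr hT (h1 S hS) (h2 S hS)
  coprod_mem J f h S hS := hS.1.coprod_mem J f fun j => h j S hS

/-- In a compactly generated category each object is of bounded size. -/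
lemma exists_card (hgen : CompactlyGen T) (X : T) :
    ∃ κ : Cardinal.{v}, Cardinal.aleph0 ≤ κ ∧ Kcl (IsCompactObj T) κ X := by
  obtain ⟨ι, g, hg, hL⟩ := hgen
  have hX : X ∈ Loc T (Set.range g) := by rw [hL]; trivial
  refine Loc_le (S := {X | ∃ κ : Cardinal.{v}, Cardinal.aleph0 ≤ κ ∧ Kcl (IsCompactObj T) κ X})
    ?_ ?_ hX
  · refine ⟨?_, ?_, ?_, ?_, ?_⟩
    · exact fun X h => ⟨_, le_rfl, .zero X h⟩
    · rintro X Y e ⟨κ, h1, h2⟩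
      exact ⟨κ, h1, .iso e h2⟩
    · rintro X ⟨κ, h1, h2⟩ n
      exact ⟨κ, h1, .shift X n h2⟩
    · rintro Tr hT ⟨κ, h1, h2⟩ ⟨μ, h3, h4⟩
      exact ⟨max κ μ, h1.trans (le_max_left _ _), .cone Tr hT
        (h2.mono (fun X h => .base X h) (le_max_left _ _))
        (h4.mono (fun X h => .base X h) (le_max_right _ _))⟩
    · intro J f hf
      choose κ h1 h2 using hf
      refine ⟨max Cardinal.aleph0 (max (Cardinal.mk J) (Cardinal.sum κ)), le_max_left _ _,
        .coprod J f ((le_max_left _ _).trans (le_max_right _ _)) fun j => ?_⟩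
      exact (h2 j).mono (fun X h => .base X h)
        ((Cardinal.le_sum κ j).trans ((le_max_right _ _).trans (le_max_right _ _)))
  · rintro _ ⟨i, rfl⟩
    exact ⟨_, le_rfl, .base _ (hg i)⟩

end Aux

end BIK

namespace BIK

open scoped ZeroObject

section Aux2

variable {T : Type u'} [Category.{v} T] [HasZeroObject T] [Preadditive T] [HasShift T ℤ]
  [∀ n : ℤ, (CategoryTheory.shiftFunctor T n).Additive] [Pretriangulated T]
  [HasCoproducts.{v} T]

/-- The morphism `f : K ⟶ ∐ Y` factors through a coproduct of morphisms from small objects. -/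
def Good (P : T → Prop) (κ : Cardinal.{v}) {K : T} {J : Type v} (Y : J → T) (f : K ⟶ ∐ Y) : Prop :=
  ∃ (Z : J → T) (s : Set J) (z : ∀ j, Z j ⟶ Y j) (u : K ⟶ ∐ Z), Cardinal.mk s ≤ κ ∧
    (∀ j, j ∉ s → IsZero (Z j)) ∧ (∀ j, Kcl P κ (Z j)) ∧ u ≫ Limits.Sigma.map z = f

lemma mk_union_le_of {J : Type v} {κ : Cardinal.{v}} (hκ : Cardinal.aleph0 ≤ κ) {s t : Set J}
    (hs : Cardinal.mk s ≤ κ) (ht : Cardinal.mk t ≤ κ) : Cardinal.mk (s ∪ t : Set J) ≤ κ :=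
  (Cardinal.mk_union_le s t).trans ((add_le_add hs ht).trans (Cardinal.add_eq_self hκ).le)

lemma Good.add {P : T → Prop} {κ : Cardinal.{v}} (hκ : Cardinal.aleph0 ≤ κ) {K : T} {J : Type v}
    {Y : J → T} {f g : K ⟶ ∐ Y} (hf : Good P κ Y f) (hg : Good P κ Y g) : Good P κ Y (f + g) := by
  obtain ⟨Z, s, z, u, h1, h2, h3, h4⟩ := hf
  obtain ⟨Z', s', z', u', h1', h2', h3', h4'⟩ := hg
  refine ⟨fun j => Z j ⊞ Z' j, s ∪ s', fun j => biprod.desc (z j) (z' j),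
    u ≫ Limits.Sigma.map (fun j => biprod.inl) + u' ≫ Limits.Sigma.map (fun j => biprod.inr),
    mk_union_le_of hκ h1 h1', ?_, fun j => (Kcl.isTri P κ).biprod (h3 j) (h3' j), ?_⟩
  · intro j hj
    rw [Set.mem_union, not_or] at hj
    exact (biprod_isZero_iff _ _).2 ⟨h2 j hj.1, h2' j hj.2⟩
  · rw [Preadditive.add_comp, Category.assoc, Category.assoc, Sigma.map_comp_map,
      Sigma.map_comp_map]
    simp only [biprod.inl_desc, biprod.inr_desc, h4, h4']

lemma Good.precomp {P : T → Prop} {κ : Cardinal.{v}} {K L : T} {J : Type v}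
    {Y : J → T} {f : K ⟶ ∐ Y} (hf : Good P κ Y f) (k : L ⟶ K) : Good P κ Y (k ≫ f) := by
  obtain ⟨Z, s, z, u, h1, h2, h3, h4⟩ := hf
  exact ⟨Z, s, z, k ≫ u, h1, h2, h3, by rw [Category.assoc, h4]⟩

lemma Good.zero (P : T → Prop) (κ : Cardinal.{v}) (K : T) {J : Type v}
    (Y : J → T) : Good P κ Y (0 : K ⟶ ∐ Y) :=
  ⟨fun _ => 0, ∅, fun _ => 0, 0, by simp, fun _ _ => isZero_zero T,
    fun _ => .zero _ (isZero_zero T), zero_comp⟩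

lemma Good.single {P : T → Prop} {κ : Cardinal.{v}} (hκ : Cardinal.aleph0 ≤ κ) {K : T}
    (hK : Kcl P κ K) {J : Type v} (Y : J → T) (j : J) (k : K ⟶ Y j) :
    Good P κ Y (k ≫ Sigma.ι Y j) := by
  classical
  refine ⟨fun i => if i = j then K else 0, {j},
    fun i => if h : i = j then eqToHom (by simp [h]) ≫ k ≫ eqToHom (by rw [h]) else 0,
    eqToHom (by simp) ≫ Sigma.ι (fun i => if i = j then K else 0) j, ?_, ?_, ?_, ?_⟩
  · simpa using Cardinal.one_le_aleph0.trans hκ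
  · intro i hi
    have hi' : i ≠ j := hi
    simp only [if_neg hi']
    exact isZero_zero T
  · intro i
    by_cases h : i = j
    · simpa only [if_pos h] using hK
    · simp only [if_neg h]
      exact .zero _ (isZero_zero T)
  · simp

/-- The adjunction between a shift and its inverse. -/
noncomputable def shiftAdj (n m : ℤ) (h : n + m = 0) : shiftFunctor T n ⊣ shiftFunctor T m :=
  (shiftEquiv' T n m h).toAdjunction

lemma good_shift {P : T → Prop} {κ : Cardinal.{v}} {K : T}
    (hK : ∀ (J : Type v) (Y : J → T) (f : K ⟶ ∐ Y), Good P κ Y f) (n : ℤ)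
    (J : Type v) (Y : J → T) (f : K⟦n⟧ ⟶ ∐ Y) : Good P κ Y f := by
  let adj := shiftAdj (T := T) n (-n) (by simp)
  obtain ⟨Z, s, z, u, h1, h2, h3, h4⟩ :=
    hK J (fun j => (Y j)⟦-n⟧) (adj.homEquiv K _ f ≫ (shiftSigma Y (-n)).hom)
  have h5 : adj.homEquiv K _ f = (u ≫ Limits.Sigma.map z) ≫ (shiftSigma Y (-n)).inv := by
    rw [h4, Category.assoc, Iso.hom_inv_id, Category.comp_id]
  have h6 : f = (u ≫ Limits.Sigma.map z)⟦n⟧' ≫ (adj.homEquiv _ _).symm (shiftSigma Y (-n)).inv := by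
    rw [← Adjunction.homEquiv_naturality_left_symm, ← h5, Equiv.symm_apply_apply]
  refine ⟨fun j => (Z j)⟦n⟧, s, fun j => (adj.homEquiv _ _).symm (z j),
    u⟦n⟧' ≫ (shiftSigma Z n).hom, h1, ?_, fun j => .shift _ _ (h3 j), ?_⟩
  · intro j hj
    exact (shiftFunctor T n).map_isZero (h2 j hj)
  · rw [h6, Functor.map_comp, Category.assoc, Category.assoc]
    congr 1
    rw [← Iso.eq_inv_comp]
    ext j
    rw [Sigma.ι_map, ← Category.assoc, ι_shiftSigma_inv, ← Category.assoc, ← Functor.map_comp,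
      Sigma.ι_map, ← Adjunction.homEquiv_naturality_left_symm,
      Category.assoc, ι_shiftSigma_inv, ← Adjunction.homEquiv_naturality_right_symm]

lemma good_iso {P : T → Prop} {κ : Cardinal.{v}} {K L : T} (e : K ≅ L)
    (hK : ∀ (J : Type v) (Y : J → T) (f : K ⟶ ∐ Y), Good P κ Y f)
    (J : Type v) (Y : J → T) (f : L ⟶ ∐ Y) : Good P κ Y f := by
  have := (hK J Y (e.hom ≫ f)).precomp e.inv
  simpa using this

lemma good_cone {P : T → Prop} {κ : Cardinal.{v}} (hκ : Cardinal.aleph0 ≤ κ) {K' K K'' : T}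
    {a : K' ⟶ K} {b : K ⟶ K''} {c : K'' ⟶ K'⟦(1 : ℤ)⟧} (hT : Triangle.mk a b c ∈ distTriang T)
    (hK' : ∀ (J : Type v) (Y : J → T) (f : K' ⟶ ∐ Y), Good P κ Y f)
    (hK : ∀ (J : Type v) (Y : J → T) (f : K ⟶ ∐ Y), Good P κ Y f)
    (J : Type v) (Y : J → T) (f : K'' ⟶ ∐ Y) : Good P κ Y f := by
  obtain ⟨Z, s, z, u, h1, h2, h3, h4⟩ := hK J Y (b ≫ f)
  choose F i w hF using fun j => ex_fiber (z j)
  obtain ⟨l, hl⟩ := sigma_exact hF (a ≫ u) (by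
    rw [Category.assoc, h4, ← Category.assoc, tri_comp hT, zero_comp])
  obtain ⟨Z', s', z', u', h1', h2', h3', h4'⟩ := hK' J F l
  choose Z'' p q hZ'' using fun j => ex_cone (z' j ≫ i j)
  choose z'' hz'' using fun j => tri_desc (hZ'' j) (z j) (by
    rw [Category.assoc, tri_comp (hF j), comp_zero])
  have e1 : a ≫ u ≫ Limits.Sigma.map p = 0 := by
    rw [← Category.assoc, ← hl, ← h4', Category.assoc, Category.assoc, Sigma.map_comp_map,
      Sigma.map_comp_map]
    have : (fun j => z' j ≫ i j ≫ p j) = fun j => 0 := by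
      funext j
      rw [← Category.assoc, tri_comp (hZ'' j)]
    rw [this]
    have h0 : Limits.Sigma.map (fun j => (0 : Z' j ⟶ Z'' j)) = 0 := by ext j; simp
    rw [h0, comp_zero]
  obtain ⟨u'', hu''⟩ := tri_desc hT _ e1
  have e2 : b ≫ (f - u'' ≫ Limits.Sigma.map z'') = 0 := by
    rw [Preadditive.comp_sub, ← Category.assoc, hu'', Category.assoc, Sigma.map_comp_map]
    simp only [hz'', h4, sub_self]
  obtain ⟨d, hd⟩ := tri_desc' hT _ e2
  have hf : f = u'' ≫ Limits.Sigma.map z'' + c ≫ d := by rw [hd]; abel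
  rw [hf]
  refine Good.add hκ ⟨Z'', s ∪ s', z'', u'', mk_union_le_of hκ h1 h1', ?_, ?_, rfl⟩
    ((good_shift hK' 1 J Y d).precomp c)
  · intro j hj
    rw [Set.mem_union, not_or] at hj
    exact Triangle.isZero₃_of_isZero₁₂ _ (hZ'' j) (h2' j hj.2) (h2 j hj.1)
  · exact fun j => (Kcl.isTri P κ).cone (hZ'' j) (h3' j) (h3 j)

lemma good_coprod {P : T → Prop} {κ : Cardinal.{v}} (hκ : Cardinal.aleph0 ≤ κ) {L : Type v}
    (hL : Cardinal.mk L ≤ κ) (K : L → T)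
    (hK : ∀ (l : L) (J : Type v) (Y : J → T) (f : K l ⟶ ∐ Y), Good P κ Y f)
    (J : Type v) (Y : J → T) (f : ∐ K ⟶ ∐ Y) : Good P κ Y f := by
  choose Z s z u h1 h2 h3 h4 using fun l => hK l J Y (Sigma.ι K l ≫ f)
  refine ⟨fun j => ∐ fun l => Z l j, ⋃ l, s l, fun j => Sigma.desc fun l => z l j,
    Sigma.desc fun l => u l ≫ Limits.Sigma.map fun j => Sigma.ι (fun l => Z l j) l,
    ?_, ?_, fun j => .coprod _ _ hL fun l => h3 l j, ?_⟩
  · refine (Cardinal.mk_iUnion_le_sum_mk).trans ((Cardinal.sum_le_sum _ _ h1).trans ?_)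
    rw [Cardinal.sum_const']
    exact (mul_le_mul' hL le_rfl).trans (Cardinal.mul_eq_self hκ).le
  · intro j hj
    rw [Set.mem_iUnion, not_exists] at hj
    rw [IsZero.iff_id_eq_zero]
    ext l
    exact (h2 l j (hj l)).eq_of_src _ _
  · ext l
    rw [Sigma.ι_desc_assoc, Category.assoc, Sigma.map_comp_map, ← h4]
    simp

theorem claim1 {κ : Cardinal.{v}} (hκ : Cardinal.aleph0 ≤ κ) {K : T}
    (hK : Kcl (IsCompactObj T) κ K) :
    ∀ (J : Type v) (Y : J → T) (f : K ⟶ ∐ Y), Good (IsCompactObj T) κ Y f := by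
  induction hK with
  | base X h =>
    classical
    intro J Y f
    obtain ⟨x, rfl⟩ := (h J Y).2 f
    induction x using DirectSum.induction_on with
    | zero => rw [map_zero]; exact Good.zero _ _ _ _
    | of j g =>
      have : sigmaHom T X Y (DirectSum.of (fun j => (X ⟶ Y j)) j g) = g ≫ Sigma.ι Y j := by
        unfold sigmaHom
        convert DirectSum.toAddMonoid_of (β := fun j => (X ⟶ Y j)) _ j g
        rfl
      rw [this]
      exact Good.single hκ (.base _ h) _ _ _
    | add x y hx hy => rw [map_add]; exact hx.add hκ hy
  | zero X h =>
    intro J Y f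
    rw [h.eq_of_src f 0]
    exact Good.zero _ _ _ _
  | iso e _ ih => exact good_iso e ih
  | shift X n _ ih => exact good_shift ih n
  | cone Tr hT _ _ ih1 ih2 => exact good_cone hκ hT ih1 ih2
  | coprod J f hJ _ ih => exact good_coprod hκ hJ f ih

end Aux2

end BIK

namespace BIK

section Aux3

variable {T : Type u'} [Category.{v} T] [HasZeroObject T] [Preadditive T] [HasShift T ℤ]
  [∀ n : ℤ, (CategoryTheory.shiftFunctor T n).Additive] [Pretriangulated T]
  [HasCoproducts.{v} T]

/-- Each morphism from an object in `Q` to `A` factors through an object in `G`. -/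
def Fac (Q G : T → Prop) (A : T) : Prop :=
  ∀ (K : T), Q K → ∀ k : K ⟶ A, ∃ (Z : T) (a : K ⟶ Z) (b : Z ⟶ A), G Z ∧ a ≫ b = k

lemma Fac.shift {Q G : T → Prop} (hQ : IsTri Q) (hG : IsTri G) {A : T} (hA : Fac Q G A) (n : ℤ) :
    Fac Q G (A⟦n⟧) := by
  intro K hK k
  let adj := shiftAdj (T := T) (-n) n (by simp)
  obtain ⟨Z, a, b, hZ, hab⟩ := hA _ (hQ.shift_mem K hK (-n)) ((adj.homEquiv _ _).symm k)
  refine ⟨Z⟦n⟧, adj.homEquiv _ _ a, b⟦n⟧', hG.shift_mem _ hZ n, ?_⟩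
  rw [← Adjunction.homEquiv_naturality_right, hab, Equiv.apply_symm_apply]

lemma Fac.cone {Q G : T → Prop} (hQ : IsTri Q) (hG : IsTri G) (hGQ : ∀ X, G X → Q X) {A' A A'' : T}
    {α : A' ⟶ A} {β : A ⟶ A''} {γ : A'' ⟶ A'⟦(1 : ℤ)⟧}
    (hT : Triangle.mk α β γ ∈ distTriang T) (hA' : Fac Q G A') (hA : Fac Q G A) :
    Fac Q G A'' := by
  intro K hK k
  have hT1 := tri_rot hT
  have hT2 := tri_rot hT1
  obtain ⟨G', a, b, hG', hab⟩ := hA'.shift hQ hG 1 K hK (k ≫ γ)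
  obtain ⟨N, n, w, hN⟩ := ex_cone a
  obtain ⟨l, hl⟩ := tri_desc hN (b ≫ (-α⟦(1 : ℤ)⟧')) (by
    rw [← Category.assoc, hab, Category.assoc, tri_comp hT2, comp_zero])
  obtain ⟨G1, c, d, hG1, hcd⟩ := hA.shift hQ hG 1 N (hQ.cone hN hK (hGQ _ hG')) l
  obtain ⟨G2, e, w2, hG2⟩ := ex_fiber (n ≫ c)
  obtain ⟨t, ht⟩ := tri_lift hG2 a (by
    rw [← Category.assoc, tri_comp hN, zero_comp])
  obtain ⟨r, hr⟩ := tri_map1 hG2 hT2 b d (by rw [Category.assoc, hcd, hl])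
  obtain ⟨m, hm⟩ := tri_lift hT1 (k - t ≫ r) (by
    rw [Preadditive.sub_comp, Category.assoc, ← hr, ← Category.assoc, ht, hab, sub_self])
  obtain ⟨G3, x, y, hG3, hxy⟩ := hA K hK m
  refine ⟨G2 ⊞ G3, biprod.lift t x, biprod.desc r (y ≫ β),
    hG.biprod (hG.fiber hG2 hG' hG1) hG3, ?_⟩
  rw [biprod.lift_desc, ← Category.assoc x, hxy, hm]
  abel

/-- Morphisms from small objects to objects in `Loc X` factor through small objects in `Loc X`. -/
theorem claim2 {κ : Cardinal.{v}} (hκ : Cardinal.aleph0 ≤ κ) {X : T}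
    (hX : Kcl (IsCompactObj T) κ X) {A : T} (hA : A ∈ Loc T {X}) :
    Fac (Kcl (IsCompactObj T) κ) (Kcl (fun Y => Y = X) κ) A := by
  have hQ := Kcl.isTri (IsCompactObj T) κ
  have hG := Kcl.isTri (fun Y => Y = X) κ
  have hGQ : ∀ Y, Kcl (fun Y => Y = X) κ Y → Kcl (IsCompactObj T) κ Y :=
    fun Y h => h.mono (by rintro _ rfl; exact hX) le_rfl
  refine Loc_le (S := {A | Fac (Kcl (IsCompactObj T) κ) (Kcl (fun Y => Y = X) κ) A}) ?_ ?_ hA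
  · refine ⟨?_, ?_, ?_, ?_, ?_⟩
    · intro A hA K hK k
      exact ⟨A, k, 𝟙 A, .zero A hA, Category.comp_id _⟩
    · intro A B e hA K hK k
      obtain ⟨Z, a, b, hZ, hab⟩ := hA K hK (k ≫ e.inv)
      exact ⟨Z, a, b ≫ e.hom, hZ, by rw [← Category.assoc, hab]; simp⟩
    · exact fun A hA n => Fac.shift hQ hG hA n
    · exact fun Tr hT h1 h2 => Fac.cone hQ hG hGQ hT h1 h2
    · intro J A hA K hK k
      classical
      obtain ⟨Z, s, z, u, h1, h2, h3, h4⟩ := claim1 hκ hK J A k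
      have : ∀ j, ∃ (W : T) (a : Z j ⟶ W) (b : W ⟶ A j), Kcl (fun Y => Y = X) κ W ∧
          a ≫ b = z j ∧ (j ∉ s → IsZero W) := by
        intro j
        by_cases hj : j ∈ s
        · obtain ⟨W, a, b, hW, hab⟩ := hA j (Z j) (h3 j) (z j)
          exact ⟨W, a, b, hW, hab, fun h => absurd hj h⟩
        · exact ⟨Z j, 𝟙 _, z j, .zero _ (h2 j hj), Category.id_comp _, fun _ => h2 j hj⟩
      choose W a b hW hab hs using this
      refine ⟨∐ W, u ≫ Limits.Sigma.map a, Limits.Sigma.map b,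
        Kcl.coprod_supp W s hs h1 hW, ?_⟩
      rw [Category.assoc, Sigma.map_comp_map]
      simp only [hab, h4]
  · rintro _ rfl K hK k
    exact ⟨_, k, 𝟙 _, .base _ rfl, Category.comp_id _⟩

/-- The perfectness of the small objects in `Loc X`. -/
theorem perfect {κ : Cardinal.{v}} (hκ : Cardinal.aleph0 ≤ κ) {X : T}
    (hX : Kcl (IsCompactObj T) κ X) {J : Type v} (A : J → T) (hA : ∀ j, A j ∈ Loc T {X})
    {G : T} (hG : Kcl (fun Y => Y = X) κ G) (k : G ⟶ ∐ A) :
    ∃ (Z : J → T) (z : ∀ j, Z j ⟶ A j) (u : G ⟶ ∐ Z), (∀ j, Kcl (fun Y => Y = X) κ (Z j)) ∧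
      u ≫ Limits.Sigma.map z = k := by
  obtain ⟨Z, s, z, u, h1, h2, h3, h4⟩ := claim1 hκ
    (hG.mono (by rintro _ rfl; exact hX) le_rfl) J A k
  choose W a b hW hab using fun j => claim2 hκ hX (hA j) (Z j) (h3 j) (z j)
  refine ⟨W, b, u ≫ Limits.Sigma.map a, hW, ?_⟩
  rw [Category.assoc, Sigma.map_comp_map]
  simp only [hab, h4]

/-- A small family of objects. -/
structure Fam (T : Type u') where
  idx : Type v
  obj : idx → T

/-- The isomorphism closure of a family. -/
def Fam.Rng (F : Fam.{v} T) (Z : T) : Prop := ∃ i, Nonempty (Z ≅ F.obj i)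

/-- The index type of the one-step closure of a family. -/
inductive StepIdx (I : Type v) (F : Fam.{v} T) : Type v
  | base
  | zero
  | shift (i : F.idx) (n : ℤ)
  | cone (i j : F.idx) (f : F.obj i ⟶ F.obj j)
  | coprod (s : Set I) (φ : s → F.idx)

open scoped ZeroObject in
/-- The objects of the one-step closure of a family. -/
noncomputable def stepObj (X : T) (I : Type v) (F : Fam.{v} T) : StepIdx I F → T
  | .base => X
  | .zero => 0
  | .shift i n => (F.obj i)⟦n⟧
  | .cone _ _ f => (ex_cone f).choose
  | .coprod _ φ => ∐ fun j => F.obj (φ j)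

/-- The one-step closure of a family. -/
noncomputable def stepFam (X : T) (I : Type v) (F : Fam.{v} T) : Fam.{v} T :=
  ⟨StepIdx I F, stepObj X I F⟩

lemma step_cone (X : T) (I : Type v) (F : Fam.{v} T) (Tr : Triangle T) (hT : Tr ∈ distTriang T)
    (h1 : F.Rng Tr.obj₁) (h2 : F.Rng Tr.obj₂) : (stepFam X I F).Rng Tr.obj₃ := by
  obtain ⟨i, ⟨e1⟩⟩ := h1
  obtain ⟨j, ⟨e2⟩⟩ := h2
  obtain ⟨g, w, h⟩ := (ex_cone (e1.inv ≫ Tr.mor₁ ≫ e2.hom)).choose_spec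
  exact ⟨.cone i j (e1.inv ≫ Tr.mor₁ ≫ e2.hom),
    ⟨Triangle.π₃.mapIso (isoTriangleOfIso₁₂ Tr _ hT h e1 e2
      (e1.hom_inv_id_assoc _).symm)⟩⟩

lemma step_coprod (X : T) (I : Type v) (F : Fam.{v} T) (J : Type v) (f : J → T) (e : J ↪ I)
    (hf : ∀ j, F.Rng (f j)) : (stepFam X I F).Rng (∐ f) := by
  choose i hi using hf
  let ε : J ≃ Set.range e := Equiv.ofInjective e e.injective
  refine ⟨.coprod (Set.range e) (fun x => i (ε.symm x)), ⟨?_⟩⟩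
  refine Sigma.whiskerEquiv ε fun j => ?_
  exact eqToIso (by simp) ≪≫ (hi j).some.symm

/-- The family of objects in all previous stages. -/
def prevFam {W : Type v} [LT W] (b : W) (F : ∀ c : W, c < b → Fam.{v} T) : Fam.{v} T :=
  ⟨Σ c : {c : W // c < b}, (F c.1 c.2).idx, fun x => (F x.1.1 x.1.2).obj x.2⟩

/-- `Kcl X` is essentially small. -/
theorem small_Kcl {κ : Cardinal.{v}} (hκ : Cardinal.aleph0 ≤ κ) (X : T) :
    ∃ F : Fam.{v} T, (∀ i, Kcl (fun Y => Y = X) κ (F.obj i)) ∧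
      ∀ Z, Kcl (fun Y => Y = X) κ Z → F.Rng Z := by
  have hreg : Cardinal.IsRegular (Order.succ κ) := Cardinal.isRegular_succ hκ
  have : Fact (Order.succ κ).IsRegular := ⟨hreg⟩
  let W := (Order.succ κ).ord.ToType
  have : NoMaxOrder W := Cardinal.noMaxOrder hreg.aleph0_le
  have hbd : ∀ (J : Type v) (f : J → W), Cardinal.mk J ≤ κ → ∃ b, ∀ j, f j < b := by
    intro J f hJ
    have hJ' : HasCardinalLT J (Order.succ κ) := by
      rw [hasCardinalLT_iff_cardinal_mk_lt]
      exact Order.lt_succ_of_le hJ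
    obtain ⟨b, hb⟩ := exists_gt (IsCardinalFiltered.max f hJ')
    exact ⟨b, fun j => (leOfHom (IsCardinalFiltered.toMax f hJ' j)).trans_lt hb⟩
  let I := κ.out
  let F : W → Fam.{v} T := (wellFounded_lt (α := W)).fix fun b F => stepFam X I (prevFam b F)
  have hF : ∀ b, F b = stepFam X I (prevFam b fun c _ => F c) := fun b =>
    (wellFounded_lt (α := W)).fix_eq _ b
  have hlt : ∀ (b c : W) (Z : T), c < b → (F c).Rng Z → (prevFam b fun c _ => F c).Rng Z := by
    rintro b c Z hcb ⟨i, hi⟩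
    exact ⟨⟨⟨c, hcb⟩, i⟩, hi⟩
  have key : ∀ Z, Kcl (fun Y => Y = X) κ Z → ∃ b, (F b).Rng Z := by
    intro Z hZ
    induction hZ with
    | base Z h =>
      obtain ⟨b, _⟩ := hbd PEmpty (fun x => x.elim) (by simp)
      refine ⟨b, ?_⟩
      rw [hF b, h]
      exact ⟨.base, ⟨Iso.refl _⟩⟩
    | zero Z h =>
      obtain ⟨b, _⟩ := hbd PEmpty (fun x => x.elim) (by simp)
      refine ⟨b, ?_⟩
      rw [hF b]
      exact ⟨.zero, ⟨h.iso (isZero_zero T)⟩⟩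
    | iso e _ ih =>
      obtain ⟨b, i, ⟨hi⟩⟩ := ih
      exact ⟨b, i, ⟨e.symm ≪≫ hi⟩⟩
    | shift Z n _ ih =>
      obtain ⟨b, h⟩ := ih
      obtain ⟨c, hc⟩ := exists_gt b
      refine ⟨c, ?_⟩
      rw [hF c]
      obtain ⟨i, ⟨hi⟩⟩ := hlt c b Z hc h
      exact ⟨.shift i n, ⟨(shiftFunctor T n).mapIso hi⟩⟩
    | cone Tr hT _ _ ih1 ih2 =>
      obtain ⟨b, h⟩ := ih1
      obtain ⟨b', h'⟩ := ih2
      obtain ⟨c, hc⟩ := exists_gt (max b b')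
      refine ⟨c, ?_⟩
      rw [hF c]
      exact step_cone X I _ Tr hT (hlt c b _ ((le_max_left _ _).trans_lt hc) h)
        (hlt c b' _ ((le_max_right _ _).trans_lt hc) h')
    | coprod J f hJ _ ih =>
      choose b hb using ih
      obtain ⟨c, hc⟩ := hbd J b hJ
      refine ⟨c, ?_⟩
      rw [hF c]
      have e : Nonempty (J ↪ I) := by
        rw [← Cardinal.le_def]
        simpa [I] using hJ
      exact step_coprod X I _ J f e.some fun j => hlt c (b j) _ (hc j) (hb j)
  refine ⟨⟨Σ b : W, {i : (F b).idx // Kcl (fun Y => Y = X) κ ((F b).obj i)},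
    fun x => (F x.1).obj x.2.1⟩, fun x => x.2.2, fun Z hZ => ?_⟩
  obtain ⟨b, i, ⟨hi⟩⟩ := key Z hZ
  exact ⟨⟨b, i, hZ.iso hi⟩, ⟨hi⟩⟩

end Aux3

end BIK

namespace BIK

section Aux4

variable {T : Type u'} [Category.{v} T] [HasZeroObject T] [Preadditive T] [HasShift T ℤ]
  [∀ n : ℤ, (CategoryTheory.shiftFunctor T n).Additive] [Pretriangulated T]
  [HasCoproducts.{v} T]

lemma shift_inj {G : T → Prop} (hG : IsTri G) {P Q : T} (f : P ⟶ Q)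
    (hf : ∀ Z, G Z → ∀ h : Z ⟶ P, h ≫ f = 0 → h = 0) (n : ℤ) :
    ∀ Z, G Z → ∀ h : Z ⟶ P⟦n⟧, h ≫ f⟦n⟧' = 0 → h = 0 := by
  intro Z hZ h hh
  let adj := shiftAdj (T := T) (-n) n (by simp)
  have h1 : (adj.homEquiv Z P).symm h = 0 := by
    apply hf _ (hG.shift_mem _ hZ (-n))
    rw [← Adjunction.homEquiv_naturality_right_symm, hh, Adjunction.homEquiv_counit]
    simp
  have h2 := congrArg (adj.homEquiv Z P) h1
  rw [Equiv.apply_symm_apply] at h2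
  rw [h2, Adjunction.homEquiv_unit]
  simp

/-- The shift map on a constant coproduct. -/
noncomputable def csh (B : T) : (∐ fun _ : ULift.{v} ℕ => B) ⟶ (∐ fun _ : ULift.{v} ℕ => B) :=
  Sigma.desc fun n => Sigma.ι (fun _ : ULift.{v} ℕ => B) ⟨n.down + 1⟩

lemma ι_csh (B : T) (n : ULift.{v} ℕ) :
    Sigma.ι (fun _ : ULift.{v} ℕ => B) n ≫ csh B = Sigma.ι (fun _ : ULift.{v} ℕ => B) ⟨n.down + 1⟩ := by
  simp [csh]

lemma csh_split (B : T) : ∃ r, (𝟙 _ - csh B) ≫ r = 𝟙 _ := by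
  refine ⟨Sigma.desc fun n => -∑ i ∈ Finset.range n.down,
    Sigma.ι (fun _ : ULift.{v} ℕ => B) ⟨i⟩, ?_⟩
  ext n
  rw [← Category.assoc, Preadditive.comp_sub, ι_csh, Preadditive.sub_comp]
  simp [Finset.sum_range_succ]

section Tower

variable {G : T → Prop} (hG : IsTri G) {L : Set T} (hL : IsLocalizing T L)
  (hperf : ∀ (J : Type v) (A : J → T), (∀ j, A j ∈ L) → ∀ Z, G Z → ∀ k : Z ⟶ ∐ A,
    ∃ (W : J → T) (z : ∀ j, W j ⟶ A j) (u : Z ⟶ ∐ W), (∀ j, G (W j)) ∧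
      u ≫ Limits.Sigma.map z = k)
  {Y : T} {A : ℕ → T} (a : ∀ n, A n ⟶ A (n + 1)) (p : ∀ n, A n ⟶ Y)
  (hap : ∀ n, a n ≫ p (n + 1) = p n) (hA : ∀ n, A n ∈ L)
  (hsurj : ∀ Z, G Z → ∀ f : Z ⟶ Y, ∃ l : Z ⟶ A 0, l ≫ p 0 = f)
  (hkill : ∀ n Z, G Z → ∀ f : Z ⟶ A n, f ≫ p n = 0 → f ≫ a n = 0)

/-- The coproduct of a sequence. -/
noncomputable abbrev sq (A : ℕ → T) : T := ∐ fun n : ULift.{v} ℕ => A n.down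

/-- The shift map of a sequence. -/
noncomputable def sh : sq A ⟶ sq A :=
  Sigma.desc fun n => a n.down ≫ Sigma.ι (fun n : ULift.{v} ℕ => A n.down) ⟨n.down + 1⟩

lemma ι_sh (n : ULift.{v} ℕ) : Sigma.ι (fun n : ULift.{v} ℕ => A n.down) n ≫ sh a =
    a n.down ≫ Sigma.ι (fun n : ULift.{v} ℕ => A n.down) ⟨n.down + 1⟩ := by
  simp [sh]

/-- The composites `A 0 ⟶ A n`. -/
def a0 : ∀ n, A 0 ⟶ A n
  | 0 => 𝟙 _
  | n + 1 => a0 n ≫ a n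

/-- The composites `A 1 ⟶ A (n + 1)`. -/
def a1 : ∀ n, A 1 ⟶ A (n + 1)
  | 0 => 𝟙 _
  | n + 1 => a1 n ≫ a (n + 1)

lemma a0_succ (n : ℕ) : a0 a (n + 1) = a0 a n ≫ a n := rfl

lemma a0_eq (n : ℕ) : a0 a (n + 1) = a 0 ≫ a1 a n := by
  induction n with
  | zero => simp [a0, a1]
  | succ n ih => rw [a0_succ, ih, Category.assoc]; rfl

include hap in
lemma a0_p (n : ℕ) : a0 a n ≫ p n = p 0 := by
  induction n with
  | zero => simp [a0]
  | succ n ih => rw [a0_succ, Category.assoc, hap, ih]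

/-- The map from the constant sequence. -/
noncomputable def cc : (∐ fun _ : ULift.{v} ℕ => A 0) ⟶ sq A :=
  Limits.Sigma.map fun n : ULift.{v} ℕ => a0 a n.down

lemma ι_cc (n : ULift.{v} ℕ) : Sigma.ι (fun _ : ULift.{v} ℕ => A 0) n ≫ cc a =
    a0 a n.down ≫ Sigma.ι (fun n : ULift.{v} ℕ => A n.down) n := by
  simp [cc]

lemma csh_cc : csh (A 0) ≫ cc a = cc a ≫ sh a := by
  ext n
  rw [← Category.assoc, ι_csh, ι_cc, ← Category.assoc, ι_cc, Category.assoc, ι_sh, a0_succ,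
    Category.assoc]

lemma csh_map {B C : T} (f : B ⟶ C) :
    csh B ≫ Limits.Sigma.map (fun _ : ULift.{v} ℕ => f) =
      Limits.Sigma.map (fun _ : ULift.{v} ℕ => f) ≫ csh C := by
  ext n
  rw [← Category.assoc, ι_csh, Sigma.ι_map, Sigma.ι_map_assoc, ι_csh]

lemma csh_cc_fac : ∃ c1, csh (A 0) ≫ cc a =
    csh (A 0) ≫ Limits.Sigma.map (fun _ : ULift.{v} ℕ => a 0) ≫ c1 := by
  let b : ∀ n : ℕ, A 1 ⟶ sq A := fun n => Nat.casesOn n 0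
    (fun k => a1 a k ≫ Sigma.ι (fun n : ULift.{v} ℕ => A n.down) ⟨k + 1⟩)
  refine ⟨Sigma.desc fun n => b n.down, ?_⟩
  ext n
  rw [← Category.assoc, ι_csh, ι_cc, ← Category.assoc, ι_csh, Sigma.ι_map_assoc, Sigma.ι_desc]
  simp only [b]
  rw [a0_eq, Category.assoc]

include hperf hap hA hsurj hkill in
lemma key_step {Z : T} (hZ : G Z) (h : Z ⟶ sq A) :
    ∃ w : Z ⟶ ∐ fun _ : ULift.{v} ℕ => A 0, h ≫ sh a = w ≫ csh (A 0) ≫ cc a ∧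
      w ≫ Sigma.desc (fun _ => p 0) = h ≫ Sigma.desc fun n => p n.down := by
  obtain ⟨W, z, u, hW, rfl⟩ := hperf _ (fun n : ULift.{v} ℕ => A n.down) (fun n => hA _) Z hZ h
  choose l hl using fun n => hsurj (W n) (hW n) (z n ≫ p n.down)
  have hk : ∀ n, z n ≫ a n.down = l n ≫ a0 a (n.down + 1) := by
    intro n
    have := hkill n.down (W n) (hW n) (z n - l n ≫ a0 a n.down) (by
      rw [Preadditive.sub_comp, Category.assoc, a0_p a p hap, hl, sub_self])
    rwa [Preadditive.sub_comp, Category.assoc, ← a0_succ, sub_eq_zero] at this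
  refine ⟨u ≫ Limits.Sigma.map l, ?_, ?_⟩
  · rw [Category.assoc, Category.assoc]
    congr 1
    ext n
    rw [Sigma.ι_map_assoc, ι_sh, Sigma.ι_map_assoc, reassoc_of% (ι_csh (A 0) n), ι_cc,
      ← Category.assoc, hk, Category.assoc]
  · rw [Category.assoc, Category.assoc]
    congr 1
    ext n
    simp [hl]

include hL hperf hap hA hsurj hkill in
lemma sh_inj {Z : T} (hZ : G Z) (h : Z ⟶ sq A) (hh : h ≫ (𝟙 _ - sh a) = 0) : h = 0 := by
  rw [Preadditive.comp_sub, Category.comp_id, sub_eq_zero] at hh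
  obtain ⟨w, hw, -⟩ := key_step hperf a p hap hA hsurj hkill hZ h
  let z := w ≫ csh (A 0) ≫ (𝟙 _ - csh (A 0))
  have hz : z ≫ cc a = 0 := by
    simp only [z, Category.assoc, Preadditive.sub_comp, Category.id_comp, Preadditive.comp_sub]
    rw [csh_cc, ← csh_cc, ← hw]
    have : w ≫ csh (A 0) ≫ csh (A 0) ≫ cc a = h := by
      rw [csh_cc, ← Category.assoc, ← Category.assoc, Category.assoc w, ← hw, ← hh, ← hh]
    rw [this, ← hh, sub_self]
  choose Fb i q hF using fun n : ULift.{v} ℕ => ex_fiber (a0 a n.down)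
  obtain ⟨l, hl⟩ := sigma_exact hF z hz
  obtain ⟨W, y, u, hW, hu⟩ := hperf _ Fb
    (fun n => hL.isTri.fiber (hF n) (hA 0) (hA _)) Z hZ l
  have hz2 : z ≫ Limits.Sigma.map (fun _ : ULift.{v} ℕ => a 0) = 0 := by
    rw [← hl, ← hu, Category.assoc, Category.assoc]
    have : Limits.Sigma.map y ≫ Limits.Sigma.map i ≫
        Limits.Sigma.map (fun _ : ULift.{v} ℕ => a 0) = 0 := by
      ext n
      have := hkill 0 (W n) (hW n) (y n ≫ i n) (by
        rw [← a0_p a p hap n.down, Category.assoc, reassoc_of% (tri_comp (hF n))]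
        simp)
      rw [Category.assoc] at this
      simp [reassoc_of% this]
    rw [this, comp_zero]
  have hz3 : (w ≫ csh (A 0) ≫ Limits.Sigma.map (fun _ : ULift.{v} ℕ => a 0)) ≫
      (𝟙 _ - csh (A 1)) = 0 := by
    rw [← hz2]
    simp only [z, Category.assoc, Preadditive.sub_comp, Category.id_comp, Preadditive.comp_sub,
      Category.comp_id]
    rw [csh_map]
  obtain ⟨r, hr⟩ := csh_split (A 1)
  have hz4 : w ≫ csh (A 0) ≫ Limits.Sigma.map (fun _ : ULift.{v} ℕ => a 0) = 0 := by
    have := congrArg (fun x => x ≫ r) hz3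
    simp only [Category.assoc] at this
    rw [hr] at this
    simpa using this
  obtain ⟨c1, hc1⟩ := csh_cc_fac a
  rw [hh, hw, hc1]
  simp only [← Category.assoc] at hz4 ⊢
  rw [hz4, zero_comp]

include hG hL hperf hap hA hsurj hkill in
lemma hocolim_bij : ∃ (C : T) (π : C ⟶ Y), C ∈ L ∧
    (∀ Z, G Z → ∀ f : Z ⟶ Y, ∃ l : Z ⟶ C, l ≫ π = f) ∧
    (∀ Z, G Z → ∀ g : Z ⟶ C, g ≫ π = 0 → g = 0) := by
  obtain ⟨C, q, d, hC⟩ := ex_cone (𝟙 _ - sh a)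
  obtain ⟨π, hπ⟩ := tri_desc hC (Sigma.desc fun n => p n.down) (by
    ext n
    rw [Preadditive.sub_comp, Preadditive.comp_sub, ← Category.assoc _ (sh a), ι_sh]
    simp [hap])
  have hsq : sq A ∈ L := hL.coprod_mem _ _ fun n => hA _
  have hshq : sh a ≫ q = q := by
    have := tri_comp hC
    rw [Preadditive.sub_comp, Category.id_comp, sub_eq_zero] at this
    exact this.symm
  let j : A 0 ⟶ C := Sigma.ι (fun n : ULift.{v} ℕ => A n.down) ⟨0⟩ ≫ q
  have hj : ∀ n : ℕ, a0 a n ≫ Sigma.ι (fun n : ULift.{v} ℕ => A n.down) ⟨n⟩ ≫ q = j := by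
    intro n
    induction n with
    | zero => simp [a0, j]
    | succ n ih =>
      have := ι_sh a ⟨n⟩
      rw [a0_succ, Category.assoc, ← Category.assoc (a n), ← this, Category.assoc, hshq, ih]
  refine ⟨C, π, hL.isTri.cone hC hsq hsq, ?_, ?_⟩
  · intro Z hZ f
    obtain ⟨l, hl⟩ := hsurj Z hZ f
    refine ⟨l ≫ j, ?_⟩
    simp [j, hπ, hl]
  · intro Z hZ g hg
    have hgd : g ≫ d = 0 := by
      refine shift_inj hG (𝟙 _ - sh a)
        (fun Z hZ h hh => sh_inj hL hperf a p hap hA hsurj hkill hZ h hh) 1 Z hZ _ ?_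
      have : d ≫ (𝟙 _ - sh a)⟦(1 : ℤ)⟧' = 0 := comp_distTriang_mor_zero₃₁ _ hC
      rw [Category.assoc, this, comp_zero]
    obtain ⟨h, rfl⟩ := tri_lift' hC g hgd
    obtain ⟨w, hw, hw2⟩ := key_step hperf a p hap hA hsurj hkill hZ h
    have hcq : csh (A 0) ≫ cc a ≫ q =
        Sigma.desc (fun _ : ULift.{v} ℕ => 𝟙 (A 0)) ≫ j := by
      ext n
      rw [reassoc_of% (ι_csh (A 0) n), reassoc_of% (ι_cc a ⟨n.down + 1⟩), hj]
      simp
    have h1 : h ≫ q = (w ≫ Sigma.desc (fun _ : ULift.{v} ℕ => 𝟙 (A 0))) ≫ j := by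
      rw [← hshq, ← Category.assoc, hw]
      simp only [Category.assoc]
      rw [hcq]
    have h2 : (w ≫ Sigma.desc (fun _ : ULift.{v} ℕ => 𝟙 (A 0))) ≫ p 0 = 0 := by
      rw [Category.assoc, hπ, ← hw2] at hg
      rw [← hg, Category.assoc]
      congr 1
      ext n
      simp
    have h3 := hkill 0 Z hZ _ h2
    have h4 : j = a 0 ≫ Sigma.ι (fun n : ULift.{v} ℕ => A n.down) ⟨1⟩ ≫ q := by
      rw [← hj 1]
      simp [a0]
    rw [h1, h4, ← Category.assoc _ (a 0), h3, zero_comp]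

end Tower

/-- A stage in the construction of the approximation. -/
structure Stage (L : Set T) (Y : T) where
  A : T
  p : A ⟶ Y
  mem : A ∈ L

section Approx

variable {G : T → Prop} (hG : IsTri G) {L : Set T} (hL : IsLocalizing T L)
  (hGL : ∀ Z, G Z → Z ∈ L)
  (hsm : ∃ F : Fam.{v} T, (∀ i, G (F.obj i)) ∧ ∀ Z, G Z → F.Rng Z)

include hL hGL hsm in
lemma cover (A : T) (Q : ∀ Z : T, (Z ⟶ A) → Prop)
    (hQ : ∀ Z Z' (e : Z' ⟶ Z) (f : Z ⟶ A), Q Z f → Q Z' (e ≫ f)) :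
    ∃ (J : Type v) (U : J → T) (e : ∀ j, U j ⟶ A), (∐ U) ∈ L ∧ (∀ j, Q (U j) (e j)) ∧
      ∀ Z, G Z → ∀ f : Z ⟶ A, Q Z f → ∃ l : Z ⟶ ∐ U, l ≫ Sigma.desc e = f := by
  obtain ⟨F, hF1, hF2⟩ := hsm
  refine ⟨Σ i : F.idx, {f : F.obj i ⟶ A // Q _ f}, fun x => F.obj x.1, fun x => x.2.1,
    hL.coprod_mem _ _ fun x => hGL _ (hF1 _), fun x => x.2.2, ?_⟩
  intro Z hZ f hf
  obtain ⟨i, ⟨e⟩⟩ := hF2 Z hZ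
  refine ⟨e.hom ≫ Sigma.ι (fun x : (Σ i : F.idx, {f : F.obj i ⟶ A // Q _ f}) => F.obj x.1)
    ⟨i, e.inv ≫ f, hQ _ _ _ _ hf⟩, ?_⟩
  simp

include hL hGL hsm in
lemma next_stage {Y : T} (s : Stage L Y) : ∃ (t : Stage L Y) (a : s.A ⟶ t.A), a ≫ t.p = s.p ∧
    ∀ Z, G Z → ∀ f : Z ⟶ s.A, f ≫ s.p = 0 → f ≫ a = 0 := by
  obtain ⟨J, U, e, h1, h2, h3⟩ := cover hL hGL hsm s.A (fun Z f => f ≫ s.p = 0)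
    (fun Z Z' e f h => by rw [Category.assoc, h, comp_zero])
  obtain ⟨C, q, d, hC⟩ := ex_cone (Sigma.desc e)
  obtain ⟨π, hπ⟩ := tri_desc hC s.p (by ext j; simp [h2])
  refine ⟨⟨C, π, hL.isTri.cone hC h1 s.mem⟩, q, hπ, fun Z hZ f hf => ?_⟩
  obtain ⟨l, rfl⟩ := h3 Z hZ f hf
  rw [Category.assoc, tri_comp hC, comp_zero]

include hG hL hGL hsm in
theorem approx (hperf : ∀ (J : Type v) (A : J → T), (∀ j, A j ∈ L) → ∀ Z, G Z → ∀ k : Z ⟶ ∐ A,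
    ∃ (W : J → T) (z : ∀ j, W j ⟶ A j) (u : Z ⟶ ∐ W), (∀ j, G (W j)) ∧
      u ≫ Limits.Sigma.map z = k) (Y : T) :
    ∃ (C B : T) (π : C ⟶ Y) (q : Y ⟶ B) (d : B ⟶ C⟦(1 : ℤ)⟧),
      Triangle.mk π q d ∈ distTriang T ∧ C ∈ L ∧ ∀ Z, G Z → ∀ f : Z ⟶ B, f = 0 := by
  obtain ⟨J, U, e, h1, -, h3⟩ := cover hL hGL hsm Y (fun _ _ => True) (fun _ _ _ _ _ => trivial)
  choose nx a ha hk using fun s : Stage L Y => next_stage hL hGL hsm s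
  let st : ℕ → Stage L Y := fun n => Nat.rec ⟨∐ U, Sigma.desc e, h1⟩ (fun _ s => nx s) n
  obtain ⟨C, π, hC, hs, hi⟩ := hocolim_bij hG hL hperf (Y := Y) (A := fun n => (st n).A)
    (fun n => a (st n)) (fun n => (st n).p) (fun n => ha (st n)) (fun n => (st n).mem)
    (fun Z hZ f => h3 Z hZ f trivial) (fun n => hk (st n))
  obtain ⟨B, q, d, hB⟩ := ex_cone π
  refine ⟨C, B, π, q, d, hB, hC, fun Z hZ f => ?_⟩
  have hfd : f ≫ d = 0 := by
    refine shift_inj hG π hi 1 Z hZ _ ?_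
    have : d ≫ π⟦(1 : ℤ)⟧' = 0 := comp_distTriang_mor_zero₃₁ _ hB
    rw [Category.assoc, this, comp_zero]
  obtain ⟨g, rfl⟩ := tri_lift' hB f hfd
  obtain ⟨l, rfl⟩ := hs Z hZ g
  rw [Category.assoc, tri_comp hB, comp_zero]

end Approx

theorem approx_Loc (hgen : CompactlyGen T) (X Y : T) :
    ∃ (C B : T) (π : C ⟶ Y) (q : Y ⟶ B) (d : B ⟶ C⟦(1 : ℤ)⟧),
      Triangle.mk π q d ∈ distTriang T ∧ C ∈ Loc T {X} ∧ ∀ (n : ℤ) (f : X ⟶ B⟦n⟧), f = 0 := by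
  obtain ⟨κ, hκ, hX⟩ := exists_card hgen X
  have hG := Kcl.isTri (fun Y => Y = X) κ
  have hXG : Kcl (fun Y => Y = X) κ X := .base _ rfl
  obtain ⟨C, B, π, q, d, h1, h2, h3⟩ := approx hG (Loc_localizing {X})
    (fun Z hZ => hZ.mem_of_localizing (Loc_localizing {X}) (by rintro _ rfl; exact mem_Loc rfl))
    (small_Kcl hκ X) (fun J A hA Z hZ k => perfect hκ hX A hA hZ k) Y
  refine ⟨C, B, π, q, d, h1, h2, fun n f => ?_⟩
  exact shift_inj hG (0 : B ⟶ B) (fun Z hZ h _ => h3 Z hZ h) n X hXG f (by simp)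

lemma orth_localizing {S : Set T} (hS : IsLocalizing T S) (Y : T) :
    IsLocalizing T {Z | Z ∈ S ∧ ∀ (n : ℤ) (f : Z ⟶ Y⟦n⟧), f = 0} := by
  have hsh : ∀ Z : T, (∀ (n : ℤ) (f : Z ⟶ Y⟦n⟧), f = 0) →
      ∀ (m n : ℤ) (f : Z⟦m⟧ ⟶ Y⟦n⟧), f = 0 := by
    intro Z h m n f
    let adj := shiftAdj (T := T) m (-m) (by simp)
    apply (adj.homEquiv _ _).injective
    have key : ∀ g : Z ⟶ (Y⟦n⟧)⟦-m⟧, g = 0 := fun g => by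
      have := h (n + -m) (g ≫ ((shiftFunctorAdd T n (-m)).app Y).inv)
      rw [← cancel_mono ((shiftFunctorAdd T n (-m)).app Y).inv, this, zero_comp]
    exact (key _).trans (key _).symm
  refine ⟨?_, ?_, ?_, ?_, ?_⟩
  · exact fun X h => ⟨hS.zero_mem X h, fun n f => h.eq_of_src _ _⟩
  · rintro X Z e ⟨h1, h2⟩
    refine ⟨hS.iso_mem e h1, fun n f => ?_⟩
    rw [← cancel_epi e.hom, comp_zero]
    exact h2 n _
  · rintro X ⟨h1, h2⟩ m
    exact ⟨hS.shift_mem X h1 m, hsh X h2 m⟩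
  · rintro Tr hT ⟨h1, h2⟩ ⟨h3, h4⟩
    refine ⟨hS.ext_mem Tr hT h1 h3, fun n f => ?_⟩
    obtain ⟨l, rfl⟩ := Triangle.yoneda_exact₃ _ hT f (h4 n _)
    rw [hsh _ h2 1 n l, comp_zero]
  · intro J f hf
    refine ⟨hS.coprod_mem J f fun j => (hf j).1, fun n g => ?_⟩
    ext j
    rw [comp_zero]
    exact (hf j).2 n _

theorem main_thm (hgen : CompactlyGen T) (S : Set T) (hS : IsLocalizing T S)
    (hne : ∃ X ∈ S, ¬ Limits.IsZero X) :
    IsMinimalLoc S ↔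
      ∀ X ∈ S, ¬ Limits.IsZero X → ∀ Y ∈ S, ¬ Limits.IsZero Y →
        ∃ (n : ℤ) (f : X ⟶ Y⟦n⟧), f ≠ 0 := by
  constructor
  · rintro ⟨-, -, hmin⟩ X hX hX0 Y hY hY0
    by_contra hc
    push Not at hc
    rcases hmin _ (orth_localizing hS Y) (fun Z hZ => hZ.1) with h | h
    · exact hX0 (h X ⟨hX, hc⟩)
    · have hY' : Y ∈ {Z | Z ∈ S ∧ ∀ (n : ℤ) (f : Z ⟶ Y⟦n⟧), f = 0} := by rw [h]; exact hY
      have h0 := hY'.2 0 ((shiftFunctorZero T ℤ).app Y).inv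
      apply hY0
      have h1 : 𝟙 Y = ((shiftFunctorZero T ℤ).app Y).inv ≫ ((shiftFunctorZero T ℤ).app Y).hom :=
        ((shiftFunctorZero T ℤ).app Y).inv_hom_id.symm
      rw [IsZero.iff_id_eq_zero, h1, h0, zero_comp]
  · intro hH
    refine ⟨hS, hne, fun S' hS' hle => ?_⟩
    by_cases h0 : ∀ X ∈ S', IsZero X
    · exact Or.inl h0
    · right
      push Not at h0
      obtain ⟨X, hX, hX0⟩ := h0
      refine Set.Subset.antisymm hle fun Y hY => ?_
      obtain ⟨C, B, π, q, d, hT, hC, hB⟩ := approx_Loc hgen X Y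
      have hC' : C ∈ S' := Loc_le hS' (by simpa using hX) hC
      have hBS : B ∈ S := hS.isTri.cone hT (hle hC') hY
      have hB0 : IsZero B := by
        by_contra hb
        obtain ⟨n, f, hf⟩ := hH X (hle hX) hX0 B hBS hb
        exact hf (hB n f)
      exact hS'.isTri.obj2 _ hT hC' (hS'.zero_mem _ hB0)

end Aux4

end BIK

open BIK in
/-- Lemma: a nonzero localizing subcategory `S` is minimal iff `Hom*(X,Y) ≠ 0` for all
nonzero `X, Y ∈ S`. -/
theorem statement_18
{R : Type u} [Ring R] (𝒜 : ℤ → AddSubgroup R) [GradedRing 𝒜]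
    (hcomm : IsGradedComm 𝒜) (hnoeth : IsNoetherianRing R)
    {T : Type u'} [Category.{v} T] [HasZeroObject T] [Preadditive T] [HasShift T ℤ]
    [∀ n : ℤ, (CategoryTheory.shiftFunctor T n).Additive] [Pretriangulated T]
    [HasCoproducts.{v} T]
    (hgen : CompactlyGen T)
    (A : CenterAction 𝒜 T) (B : BIKData A)
    (S : Set T) (hS : IsLocalizing T S) (hne : ∃ X ∈ S, ¬ Limits.IsZero X) :
    IsMinimalLoc S ↔
      ∀ X ∈ S, ¬ Limits.IsZero X → ∀ Y ∈ S, ¬ Limits.IsZero Y →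
        ∃ (n : ℤ) (f : X ⟶ Y⟦n⟧), f ≠ 0 := by
  exact main_thm hgen S hS hne
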